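/- Let (Ω, ℱ, P) be a probability space and T a positive integer. For each t = 1, …, T let 𝒢_t ⊆ ℋ_t ⊆ ℱ be sub-σ-algebras. For each t let S_t : Ω → ℝ be ℋ_t-measurable and integrable with E[S_t ∣ 𝒢_t] = 0 almost surely; let R_1, …, R_T : Ω → ℝ be integrable; let M_t : Ω → ℝ be integrable and satisfy E[M_t ∣ ℋ_t] = E[∑_{s=t}^T R_s ∣ ℋ_t] almost surely; and let B_t : Ω → ℝ be integrable with S_t and B_t conditionally independent given 𝒢_t. Assume that the products S_t·M_t, S_t·B_t, and S_t·(∑_{s=t}^T R_s) are integrable for every t. Then E[∑_{t=1}^T S_t·(M_t − B_t)] = E[∑_{t=1}^T S_t·∑_{s=t}^T R_s]. -/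

import Mathlib

open MeasureTheory ProbabilityTheory

/-- Conditionally independent random variables are independent under almost every
conditional measure. -/
lemma CondIndepFun.ae_indepFun_condExpKernel
    {Ω : Type*} {m mΩ : MeasurableSpace Ω} [StandardBorelSpace Ω]
    {μ : Measure Ω} [IsFiniteMeasure μ] {hm : m ≤ mΩ} {f g : Ω → ℝ}
    (h : CondIndepFun m hm f g μ)
    (hf : AEStronglyMeasurable f μ) (hg : AEStronglyMeasurable g μ) :
    ∀ᵐ ω ∂μ, IndepFun f g (condExpKernel μ m ω) := by
  have hf' := aestronglyMeasurable_trim_condExpKernel hm hf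
  have hg' := aestronglyMeasurable_trim_condExpKernel hm hg
  have hmk : CondIndepFun m hm (hf.mk f) (hg.mk g) μ := Kernel.IndepFun.congr' h hf' hg'
  have hfm := hf.stronglyMeasurable_mk.measurable
  have hgm := hg.stronglyMeasurable_mk.measurable
  rw [condIndepFun_iff_map_prod_eq_prod_map_map hfm hgm] at hmk
  filter_upwards [ae_of_ae_trim hm hmk, ae_of_ae_trim hm hf', ae_of_ae_trim hm hg']
    with ω hω hfω hgω
  refine IndepFun.congr ?_ hfω.symm hgω.symm
  rw [indepFun_iff_map_prod_eq_prod_map_map hfm.aemeasurable hgm.aemeasurable]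
  rwa [Kernel.map_apply _ (hfm.prodMk hgm), Kernel.prod_apply, Kernel.map_apply _ hfm,
    Kernel.map_apply _ hgm] at hω

/-- The conditional expectation of a product of conditionally independent random variables is
the product of their conditional expectations. -/
lemma CondIndepFun.condExp_mul
    {Ω : Type*} {m mΩ : MeasurableSpace Ω} [StandardBorelSpace Ω]
    {μ : Measure Ω} [IsFiniteMeasure μ] {hm : m ≤ mΩ} {f g : Ω → ℝ}
    (h : CondIndepFun m hm f g μ) (hf : Integrable f μ) (hg : Integrable g μ)
    (hfg : Integrable (fun ω => f ω * g ω) μ) :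
    μ[fun ω => f ω * g ω|m] =ᵐ[μ] fun ω => (μ[f|m]) ω * (μ[g|m]) ω := by
  filter_upwards [CondIndepFun.ae_indepFun_condExpKernel h hf.1 hg.1,
    condExp_ae_eq_integral_condExpKernel hm hf, condExp_ae_eq_integral_condExpKernel hm hg,
    condExp_ae_eq_integral_condExpKernel hm hfg, hf.condExpKernel_ae (m := m),
    hg.condExpKernel_ae (m := m)] with ω hω hfω hgω hfgω hfi hgi
  rw [hfω, hgω, hfgω]
  exact hω.integral_fun_mul_eq_mul_integral hfi.1 hgi.1

/-- A factor measurable with respect to `m` integrates equally against two functions with the same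
conditional expectation given `m`. -/
lemma integral_mul_congr_of_condExp_ae_eq
    {Ω : Type*} {m mΩ : MeasurableSpace Ω} {μ : Measure Ω} [IsFiniteMeasure μ] (hm : m ≤ mΩ)
    {f g g' : Ω → ℝ} (hf : StronglyMeasurable[m] f)
    (hg : Integrable g μ) (hg' : Integrable g' μ) (h : μ[g|m] =ᵐ[μ] μ[g'|m])
    (hfg : Integrable (fun ω => f ω * g ω) μ) (hfg' : Integrable (fun ω => f ω * g' ω) μ) :
    ∫ ω, f ω * g ω ∂μ = ∫ ω, f ω * g' ω ∂μ := by
  rw [← integral_condExp hm (f := fun ω => f ω * g ω),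
    ← integral_condExp hm (f := fun ω => f ω * g' ω)]
  refine integral_congr_ae ?_
  filter_upwards [condExp_mul_of_stronglyMeasurable_left hf hfg hg,
    condExp_mul_of_stronglyMeasurable_left hf hfg' hg', h] with ω h₁ h₂ h₃
  exact h₁.trans ((congrArg (f ω * ·) h₃).trans h₂.symm)

/-- Theorem 1 of the paper (unbiasedness of the gradient estimator), stated abstractly.
`𝒢 t` is the σ-algebra of the history `H_{t-1}`, `ℋ t` that of `(H_{t-1}, θ̃_t)`,
`S t` a component of the score, `M t` an admissible reward metric, `B t` an admissible
baseline, and `R s` the reward at time `s`. Then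
`E[∑_{t=1}^T S_t (M_t - B_t)] = E[∑_{t=1}^T S_t ∑_{s=t}^T R_s]`. -/
theorem unbiasedness_of_gradient_estimator
    {Ω : Type*} {mΩ : MeasurableSpace Ω} [StandardBorelSpace Ω] [Nonempty Ω]
    {μ : Measure Ω} [IsProbabilityMeasure μ]
    (T : ℕ) (hT : 0 < T)
    (𝒢 ℋ : ℕ → MeasurableSpace Ω)
    (h𝒢ℋ : ∀ t ∈ Finset.Icc 1 T, 𝒢 t ≤ ℋ t)
    (hℋ : ∀ t ∈ Finset.Icc 1 T, ℋ t ≤ mΩ)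
    (S M B R : ℕ → Ω → ℝ)
    (hSmeas : ∀ t ∈ Finset.Icc 1 T, StronglyMeasurable[ℋ t] (S t))
    (hSint : ∀ t ∈ Finset.Icc 1 T, Integrable (S t) μ)
    (hS0 : ∀ t ∈ Finset.Icc 1 T, μ[S t|𝒢 t] =ᵐ[μ] 0)
    (hRint : ∀ s ∈ Finset.Icc 1 T, Integrable (R s) μ)
    (hMint : ∀ t ∈ Finset.Icc 1 T, Integrable (M t) μ)
    (hMadm : ∀ t ∈ Finset.Icc 1 T,
      μ[M t|ℋ t] =ᵐ[μ] μ[fun ω => ∑ s ∈ Finset.Icc t T, R s ω|ℋ t])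
    (hBint : ∀ t ∈ Finset.Icc 1 T, Integrable (B t) μ)
    (hBadm : ∀ t, ∀ ht : t ∈ Finset.Icc 1 T,
      CondIndepFun (𝒢 t) ((h𝒢ℋ t ht).trans (hℋ t ht)) (S t) (B t) μ)
    (hSMint : ∀ t ∈ Finset.Icc 1 T, Integrable (fun ω => S t ω * M t ω) μ)
    (hSBint : ∀ t ∈ Finset.Icc 1 T, Integrable (fun ω => S t ω * B t ω) μ)
    (hSRint : ∀ t ∈ Finset.Icc 1 T,
      Integrable (fun ω => S t ω * ∑ s ∈ Finset.Icc t T, R s ω) μ) :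
    ∫ ω, ∑ t ∈ Finset.Icc 1 T, S t ω * (M t ω - B t ω) ∂μ
      = ∫ ω, ∑ t ∈ Finset.Icc 1 T, S t ω * ∑ s ∈ Finset.Icc t T, R s ω ∂μ := by
  have hSB : ∀ t ∈ Finset.Icc 1 T, ∫ ω, S t ω * B t ω ∂μ = 0 := fun t ht => by
    rw [← integral_condExp ((h𝒢ℋ t ht).trans (hℋ t ht))]
    refine integral_eq_zero_of_ae ?_
    filter_upwards [CondIndepFun.condExp_mul (hBadm t ht) (hSint t ht) (hBint t ht) (hSBint t ht),
      hS0 t ht] with ω h₁ h₂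
    simp [h₁, h₂]
  simp only [mul_sub]
  rw [integral_finsetSum _ fun t ht => by exact (hSMint t ht).sub (hSBint t ht),
    integral_finsetSum _ hSRint]
  refine Finset.sum_congr rfl fun t ht => ?_
  rw [integral_sub (hSMint t ht) (hSBint t ht), hSB t ht, sub_zero]
  refine integral_mul_congr_of_condExp_ae_eq (hℋ t ht) (hSmeas t ht) (hMint t ht) ?_
    (hMadm t ht) (hSMint t ht) (hSRint t ht)
  exact integrable_finsetSum _ fun s hs =>
    hRint s (Finset.Icc_subset_Icc_left (Finset.mem_Icc.1 ht).1 hs)
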